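/- (Optimality condition III) Suppose X is a real Banach space, D is a nonempty generalized polyhedral convex set, f is a proper generalized polyhedral convex function, and the set D − dom f = {d − x : d ∈ D, x ∈ dom f} is a generalized polyhedral convex set. Then x ∈ D ∩ dom f is a solution of problem (P) if and only if 0 ∈ ∂f(x) + N_D(x). -/

import Mathlib

open scoped Pointwise

/-- A generalized polyhedral convex set: the intersection of a closed affine subspace
with finitely many closed half-spaces. -/
def IsGPCS {X : Type*} [AddCommGroup X] [Module ℝ X] [TopologicalSpace X] (S : Set X) : Prop :=
  ∃ (p : ℕ) (xs : Fin p → X →L[ℝ] ℝ) (α : Fin p → ℝ) (L : AffineSubspace ℝ X),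
    IsClosed (L : Set X) ∧ S = {x | x ∈ L ∧ ∀ i, xs i x ≤ α i}

theorem farkas_aux {ι V : Type*} [AddCommGroup V] [Module ℝ V] [DecidableEq ι] (s : Finset ι) :
    ∀ (φ : ι → V →ₗ[ℝ] ℝ) (ψ : V →ₗ[ℝ] ℝ),
      (∀ x, (∀ i ∈ s, φ i x ≤ 0) → ψ x ≤ 0) →
      ∃ c : ι → ℝ, (∀ i, 0 ≤ c i) ∧ ∀ x, ψ x = ∑ i ∈ s, c i * φ i x := by
  induction s using Finset.induction_on with
  | empty =>
    intro φ ψ h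
    refine ⟨0, fun _ => le_rfl, fun x => ?_⟩
    have h1 := h x (by simp)
    have h2 := h (-x) (by simp)
    simp at h2 ⊢
    linarith
  | insert n s hn ih =>
    intro φ ψ h
    by_cases hc : ∀ x, (∀ i ∈ s, φ i x ≤ 0) → ψ x ≤ 0
    · obtain ⟨c, hc0, hc⟩ := ih φ ψ hc
      refine ⟨fun i => if i = n then 0 else c i, fun i => ?_, fun x => ?_⟩
      · dsimp only
        split_ifs
        · exact le_rfl
        · exact hc0 i
      · rw [Finset.sum_insert hn, hc x]
        simp only [if_true, zero_mul, zero_add]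
        refine Finset.sum_congr rfl fun i hi => ?_
        rw [if_neg (ne_of_mem_of_not_mem hi hn)]
    · push Not at hc
      obtain ⟨x0, hx0, hψ⟩ := hc
      have hpos : 0 < φ n x0 := by
        by_contra hle
        push Not at hle
        have := h x0 (by
          intro i hi
          rcases Finset.mem_insert.1 hi with rfl | hi
          · exact hle
          · exact hx0 i hi)
        linarith
      set k := (φ n x0)⁻¹ with hk
      have hk0 : 0 < k := inv_pos.2 hpos
      have hkn : k * φ n x0 = 1 := inv_mul_cancel₀ hpos.ne'
      obtain ⟨c, hc0, hc⟩ := ih (fun i => φ i - (k * φ i x0) • φ n) (ψ - (k * ψ x0) • φ n) (by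
        intro x hx
        have := h (x - (k * φ n x) • x0) (by
          intro i hi
          rcases Finset.mem_insert.1 hi with rfl | hi
          · simp only [map_sub, map_smul, smul_eq_mul]
            have : k * φ i x * φ i x0 = φ i x := by
              rw [mul_right_comm, hkn, one_mul]
            linarith
          · have := hx i hi
            simp only [LinearMap.sub_apply, LinearMap.smul_apply, map_sub, map_smul,
              smul_eq_mul] at this ⊢
            linarith)
        simp only [LinearMap.sub_apply, LinearMap.smul_apply, map_sub, map_smul,
              smul_eq_mul] at this ⊢
        linarith)
      refine ⟨fun i => if i = n then k * ψ x0 - ∑ i ∈ s, c i * (k * φ i x0) else c i,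
        fun i => ?_, fun x => ?_⟩
      · dsimp only
        split_ifs
        · have : ∑ i ∈ s, c i * (k * φ i x0) ≤ 0 :=
            Finset.sum_nonpos fun i hi => mul_nonpos_of_nonneg_of_nonpos (hc0 i)
              (mul_nonpos_of_nonneg_of_nonpos hk0.le (hx0 i hi))
          have := mul_pos hk0 hψ
          linarith
        · exact hc0 i
      · rw [Finset.sum_insert hn]
        have e : ∑ i ∈ s, (if i = n then k * ψ x0 - ∑ i ∈ s, c i * (k * φ i x0) else c i) * φ i x
            = ∑ i ∈ s, c i * φ i x := by
          refine Finset.sum_congr rfl fun i hi => ?_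
          rw [if_neg (ne_of_mem_of_not_mem hi hn)]
        rw [e]
        have := hc x
        simp only [LinearMap.sub_apply, LinearMap.smul_apply, smul_eq_mul, mul_sub,
          Finset.sum_sub_distrib] at this
        have e2 : ∑ i ∈ s, c i * (k * φ i x0 * φ n x)
          = (∑ i ∈ s, c i * (k * φ i x0)) * φ n x := by
          rw [Finset.sum_mul]
          exact Finset.sum_congr rfl fun i _ => by ring
        rw [e2] at this
        simp only [if_true, sub_mul]
        linarith

theorem farkas_slack {ι V : Type*} [AddCommGroup V] [Module ℝ V] [Fintype ι]
    (φ : ι → V →ₗ[ℝ] ℝ) (r : ι → ℝ) (hr : ∀ i, 0 ≤ r i) (ψ : V →ₗ[ℝ] ℝ)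
    (h : ∀ x, (∀ i, φ i x ≤ r i) → ψ x ≤ 0) :
    ∃ c : ι → ℝ, (∀ i, 0 ≤ c i) ∧ (∀ i, c i * r i = 0) ∧ ∀ x, ψ x = ∑ i, c i * φ i x := by
  classical
  obtain ⟨c, hc0, hc⟩ := farkas_aux (Finset.univ.filter fun i => r i = 0) φ ψ (by
    intro x hx
    have ht : ∀ᶠ t : ℝ in nhdsWithin 0 (Set.Ioi 0), ∀ i, t * φ i x ≤ r i := by
      rw [Filter.eventually_all]
      intro i
      rcases (hr i).eq_or_lt with h0 | h0
      · filter_upwards [self_mem_nhdsWithin] with t ht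
        rw [← h0]
        exact mul_nonpos_of_nonneg_of_nonpos (le_of_lt ht) (hx i (by simp [← h0]))
      · apply nhdsWithin_le_nhds
        have : Filter.Tendsto (fun t : ℝ => t * φ i x) (nhds 0) (nhds (0 * φ i x)) :=
          (continuous_id.mul continuous_const).tendsto 0
        rw [zero_mul] at this
        exact (this.eventually_lt_const h0).mono fun _ h => h.le
    obtain ⟨t, ht, ht0⟩ := (ht.and self_mem_nhdsWithin).exists
    have h1 := h (t • x) (by simpa using ht)
    rw [map_smul, smul_eq_mul] at h1
    exact nonpos_of_mul_nonpos_right h1 ht0)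
  refine ⟨fun i => if r i = 0 then c i else 0, fun i => ?_, fun i => ?_, fun x => ?_⟩
  · dsimp only
    split_ifs
    · exact hc0 i
    · exact le_rfl
  · dsimp only
    split_ifs with h0
    · rw [h0, mul_zero]
    · rw [zero_mul]
  · rw [hc x, Finset.sum_filter]
    refine Finset.sum_congr rfl fun i _ => ?_
    split_ifs with h5 <;> simp [h5]

theorem fin_codim {X : Type*} [NormedAddCommGroup X] [NormedSpace ℝ X] {p : ℕ}
    (a : Fin p → X →L[ℝ] ℝ) (L : Submodule ℝ X) :
    ∃ F : Submodule ℝ X, FiniteDimensional ℝ F ∧ F ≤ L ∧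
      ∀ y ∈ L, ∃ z ∈ F, ∀ i, a i (y - z) = 0 := by
  let A : L →ₗ[ℝ] (Fin p → ℝ) := LinearMap.pi fun i => (a i : X →ₗ[ℝ] ℝ) ∘ₗ L.subtype
  obtain ⟨g, hg⟩ := A.rangeRestrict.exists_rightInverse_of_surjective A.range_rangeRestrict
  refine ⟨LinearMap.range (L.subtype ∘ₗ g), inferInstance, ?_, ?_⟩
  · rintro _ ⟨z, rfl⟩
    exact (g z).2
  · intro y hy
    refine ⟨_, ⟨A.rangeRestrict ⟨y, hy⟩, rfl⟩, fun i => ?_⟩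
    have h1 := LinearMap.congr_fun hg (A.rangeRestrict ⟨y, hy⟩)
    have h2 := congrFun (congrArg Subtype.val h1) i
    have h3 : a i (g (A.rangeRestrict ⟨y, hy⟩) : X) = a i y := h2
    rw [map_sub]
    simp [h3]

theorem annih_split {X : Type*} [NormedAddCommGroup X] [NormedSpace ℝ X] [CompleteSpace X]
    (L1 L2 : Submodule ℝ X) (h1 : IsClosed (L1 : Set X)) (h2 : IsClosed (L2 : Set X))
    (h : IsClosed ((L1 ⊔ L2 : Submodule ℝ X) : Set X)) (w : X →L[ℝ] ℝ)
    (hw : ∀ d ∈ L1, d ∈ L2 → w d = 0) :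
    ∃ H : X →L[ℝ] ℝ, (∀ d ∈ L1, H d = w d) ∧ ∀ d ∈ L2, H d = 0 := by
  haveI := h1.completeSpace_coe
  haveI := h2.completeSpace_coe
  haveI := h.completeSpace_coe
  haveI : CompleteSpace L1 := h1.completeSpace_coe
  haveI : CompleteSpace L2 := h2.completeSpace_coe
  haveI : CompleteSpace (L1 ⊔ L2 : Submodule ℝ X) := h.completeSpace_coe
  let T0 : (L1 × L2) →L[ℝ] X := L1.subtypeL.coprod L2.subtypeL
  let T : (L1 × L2) →L[ℝ] (L1 ⊔ L2 : Submodule ℝ X) := T0.codRestrict _ (by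
    intro z
    exact Submodule.add_mem_sup z.1.2 z.2.2)
  have hT : ∀ z, (T z : X) = z.1 + z.2 := fun z => rfl
  have hs : Function.Surjective T := by
    rintro ⟨y, hy⟩
    obtain ⟨a, ha, b, hb, rfl⟩ := Submodule.mem_sup.1 hy
    exact ⟨(⟨a, ha⟩, ⟨b, hb⟩), rfl⟩
  obtain ⟨C, hC, hpre⟩ := T.exists_preimage_norm_le hs
  choose s hs1 hs2 using hpre
  have key : ∀ z z' : L1 × L2, T z = T z' → w z.1 = w z'.1 := by
    intro z z' hz
    have e : (z.1 : X) + z.2 = z'.1 + z'.2 := by rw [← hT, ← hT, hz]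
    have e2 : (z.1 : X) - z'.1 = z'.2 - z.2 := by
      rw [sub_eq_sub_iff_add_eq_add, e, add_comm]
    have := hw (z.1 - z'.1 : X) (L1.sub_mem z.1.2 z'.1.2)
      (by rw [e2]; exact L2.sub_mem z'.2.2 z.2.2)
    rw [map_sub] at this
    linarith
  let g : (L1 ⊔ L2 : Submodule ℝ X) →ₗ[ℝ] ℝ :=
    { toFun := fun y => w (s y).1
      map_add' := by
        intro y z
        have := key (s (y + z)) (s y + s z) (by rw [map_add, hs1, hs1, hs1])
        rw [this]; simp
      map_smul' := by
        intro c y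
        have := key (s (c • y)) (c • s y) (by rw [map_smul, hs1, hs1])
        rw [this]; simp }
  let G := g.mkContinuous (‖w‖ * C) (by
    intro y
    calc ‖w (s y).1‖ ≤ ‖w‖ * ‖((s y).1 : X)‖ := w.le_opNorm _
      _ ≤ ‖w‖ * (C * ‖y‖) := by
        gcongr
        exact (norm_fst_le (s y)).trans (hs2 y)
      _ = _ := by ring)
  obtain ⟨H, hH, -⟩ := exists_extension_norm_eq (L1 ⊔ L2 : Submodule ℝ X) G
  refine ⟨H, fun d hd => ?_, fun d hd => ?_⟩
  · have e := hH ⟨d, Submodule.mem_sup_left hd⟩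
    have k := key (s ⟨d, Submodule.mem_sup_left hd⟩) (⟨d, hd⟩, 0) (by
      rw [hs1]; ext; simp [hT])
    exact e.trans k
  · have e := hH ⟨d, Submodule.mem_sup_right hd⟩
    have k := key (s ⟨d, Submodule.mem_sup_right hd⟩) (0, ⟨d, hd⟩) (by
      rw [hs1]; ext; simp [hT])
    refine (e.trans k).trans ?_
    simp

theorem IsGPCS.isClosed' {X : Type*} [NormedAddCommGroup X] [NormedSpace ℝ X] {S : Set X}
    (h : IsGPCS S) : IsClosed S := by
  obtain ⟨p, a, α, L, hL, rfl⟩ := h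
  have : {x | x ∈ L ∧ ∀ i, a i x ≤ α i} = (L : Set X) ∩ ⋂ i, {x | a i x ≤ α i} := by
    ext; simp
  rw [this]
  exact hL.inter (isClosed_iInter fun i => isClosed_le (a i).continuous continuous_const)

theorem dir_closed {X : Type*} [NormedAddCommGroup X] [NormedSpace ℝ X]
    (L : AffineSubspace ℝ X) (hL : IsClosed (L : Set X)) (x : X) (hx : x ∈ L) :
    IsClosed (L.direction : Set X) := by
  have : (L.direction : Set X) = (fun d => d + x) ⁻¹' (L : Set X) := by
    ext d
    simp only [SetLike.mem_coe, Set.mem_preimage]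
    exact (AffineSubspace.vadd_mem_iff_mem_direction d hx).symm
  rw [this]
  exact hL.preimage (by fun_prop)

theorem sum_closed {X : Type*} [NormedAddCommGroup X] [NormedSpace ℝ X]
    {p q : ℕ} (a : Fin p → X →L[ℝ] ℝ) (b : Fin q → X →L[ℝ] ℝ)
    (L1 L2 : Submodule ℝ X) (S : Set X) (hS : IsClosed S) (hSE : ∀ y ∈ S, y ∈ L1 ⊔ L2)
    (hMS : ∀ y ∈ L1, ∀ z ∈ L2, (∀ i, a i y = 0) → (∀ i, b i z = 0) → y + z ∈ S) :
    IsClosed ((L1 ⊔ L2 : Submodule ℝ X) : Set X) := by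
  obtain ⟨F1, hF1, hF1L, H1⟩ := fin_codim a L1
  obtain ⟨F2, hF2, hF2L, H2⟩ := fin_codim b L2
  let M1 : Submodule ℝ X := L1 ⊓ ⨅ i, LinearMap.ker (a i : X →ₗ[ℝ] ℝ)
  let M2 : Submodule ℝ X := L2 ⊓ ⨅ i, LinearMap.ker (b i : X →ₗ[ℝ] ℝ)
  have hMsub : ((M1 ⊔ M2 : Submodule ℝ X) : Set X) ⊆ S := by
    intro y hy
    obtain ⟨u, hu, v, hv, rfl⟩ := Submodule.mem_sup.1 hy
    simp only [M1, M2, Submodule.mem_inf, Submodule.mem_iInf, LinearMap.mem_ker] at hu hv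
    exact hMS u hu.1 v hv.1 hu.2 hv.2
  have hcl : (M1 ⊔ M2).topologicalClosure ≤ L1 ⊔ L2 := by
    intro y hy
    exact hSE y (closure_minimal hMsub hS hy)
  have e : L1 ⊔ L2 = (M1 ⊔ M2).topologicalClosure ⊔ (F1 ⊔ F2) := by
    apply le_antisymm
    · have hle := (M1 ⊔ M2).le_topologicalClosure
      apply sup_le
      · intro y hy
        obtain ⟨z, hz, hz'⟩ := H1 y hy
        rw [← sub_add_cancel y z]
        refine Submodule.add_mem_sup (hle (Submodule.mem_sup_left ?_)) (Submodule.mem_sup_left hz)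
        simp only [M1, Submodule.mem_inf, Submodule.mem_iInf, LinearMap.mem_ker]
        exact ⟨L1.sub_mem hy (hF1L hz), hz'⟩
      · intro y hy
        obtain ⟨z, hz, hz'⟩ := H2 y hy
        rw [← sub_add_cancel y z]
        refine Submodule.add_mem_sup (hle (Submodule.mem_sup_right ?_)) (Submodule.mem_sup_right hz)
        simp only [M2, Submodule.mem_inf, Submodule.mem_iInf, LinearMap.mem_ker]
        exact ⟨L2.sub_mem hy (hF2L hz), hz'⟩
    · exact sup_le hcl (sup_le_sup hF1L hF2L)
  rw [e]
  exact Submodule.isClosed_sup_finiteDimensional _ _ (Submodule.isClosed_topologicalClosure _)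

/-- **Optimality condition III.**  Suppose `X` is a real Banach space, `D` is a nonempty
generalized polyhedral convex set, `f` is a proper generalized polyhedral convex function
(`f = max {⟨vₖ, ·⟩ + βₖ}` on its nonempty generalized polyhedral convex domain, `+∞`
elsewhere), and `D − dom f` is a generalized polyhedral convex set.  Then
`x ∈ D ∩ dom f` solves `(P) : min {f x | x ∈ D}` iff `0 ∈ ∂f(x) + N_D(x)`. -/
theorem optimality_condition_III
    {X : Type*} [NormedAddCommGroup X] [NormedSpace ℝ X] [CompleteSpace X]
    (D : Set X) (hD : IsGPCS D) (hDne : D.Nonempty)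
    (domf : Set X) (hdomf : IsGPCS domf) (hdomne : domf.Nonempty)
    (m : ℕ) (v : Fin (m + 1) → X →L[ℝ] ℝ) (β : Fin (m + 1) → ℝ)
    (f : X → EReal)
    (hf : ∀ x ∈ domf,
      f x = ((Finset.univ.sup' Finset.univ_nonempty fun k => v k x + β k : ℝ) : EReal))
    (hf' : ∀ x ∉ domf, f x = ⊤)
    (hdiff : IsGPCS (D - domf))
    (x : X) (hxD : x ∈ D) (hxdom : x ∈ domf) :
    (∀ u ∈ D, f x ≤ f u) ↔
      (0 : X →L[ℝ] ℝ) ∈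
        ({φ : X →L[ℝ] ℝ | ∀ u : X, ((φ u - φ x : ℝ) : EReal) ≤ f u - f x} +
          {φ : X →L[ℝ] ℝ | ∀ u ∈ D, φ u - φ x ≤ 0}) := by
  have hDC := hdiff.isClosed'
  obtain ⟨p, a, α, L1, hL1, hDeq⟩ := hD
  obtain ⟨q, b, γ, L2, hL2, hCeq⟩ := hdomf
  have mD : ∀ u, u ∈ D ↔ u ∈ L1 ∧ ∀ i, a i u ≤ α i := fun u => by rw [hDeq]; rfl
  have mC : ∀ u, u ∈ domf ↔ u ∈ L2 ∧ ∀ i, b i u ≤ γ i := fun u => by rw [hCeq]; rfl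
  let g : X → ℝ := fun u => Finset.univ.sup' Finset.univ_nonempty fun k => v k u + β k
  have hfg : ∀ u ∈ domf, f u = (g u : EReal) := hf
  have hx1 := (mD x).1 hxD
  have hx2 := (mC x).1 hxdom
  constructor
  · intro hmin
    have hE : IsClosed ((L1.direction ⊔ L2.direction : Submodule ℝ X) : Set X) := by
      refine sum_closed a b _ _ (D - domf) hDC ?_ ?_
      · rintro _ ⟨d, hd, c, hc, rfl⟩
        have e : d - c = (d - x) + (x - c) := by abel
        change d - c ∈ _
        rw [e]
        exact Submodule.add_mem_sup (AffineSubspace.vsub_mem_direction ((mD d).1 hd).1 hx1.1)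
          (AffineSubspace.vsub_mem_direction hx2.1 ((mC c).1 hc).1)
      · intro y hy z hz hay hbz
        refine ⟨y + x, ?_, -z + x, ?_, by simp⟩
        · refine (mD _).2 ⟨(AffineSubspace.vadd_mem_iff_mem_direction y hx1.1).2 hy, fun i => ?_⟩
          rw [map_add, hay, zero_add]
          exact hx1.2 i
        · refine (mC _).2 ⟨(AffineSubspace.vadd_mem_iff_mem_direction (-z) hx2.1).2
            (neg_mem hz), fun i => ?_⟩
          rw [map_add, map_neg, hbz, neg_zero, zero_add]
          exact hx2.2 i
    let M0 : Submodule ℝ X := L1.direction ⊓ L2.direction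
    let res : (X →L[ℝ] ℝ) → (M0 × ℝ →ₗ[ℝ] ℝ) := fun w =>
      ((w : X →ₗ[ℝ] ℝ) ∘ₗ M0.subtype) ∘ₗ LinearMap.fst ℝ M0 ℝ
    have hres : ∀ w (z : M0 × ℝ), res w z = w z.1 := fun _ _ => rfl
    obtain ⟨c, hc0, hcr, hc⟩ := farkas_slack
      (ι := Fin p ⊕ Fin q ⊕ Fin (m + 1)) (V := M0 × ℝ)
      (Sum.elim (fun i => res (a i)) (Sum.elim (fun j => res (b j))
        (fun k => res (v k) - LinearMap.snd ℝ M0 ℝ)))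
      (Sum.elim (fun i => α i - a i x) (Sum.elim (fun j => γ j - b j x)
        (fun k => g x - (v k x + β k))))
      (by
        rintro (i | j | k)
        · exact sub_nonneg.2 (hx1.2 i)
        · exact sub_nonneg.2 (hx2.2 j)
        · exact sub_nonneg.2 (Finset.le_sup' (fun k => v k x + β k) (Finset.mem_univ k)))
      (-LinearMap.snd ℝ M0 ℝ)
      (by
        rintro ⟨⟨d, hd⟩, t⟩ hz
        have hd1 : d + x ∈ D := (mD _).2
          ⟨(AffineSubspace.vadd_mem_iff_mem_direction d hx1.1).2 hd.1, fun i => by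
            have := hz (Sum.inl i)
            simp only [Sum.elim_inl, hres] at this
            rw [map_add]; linarith⟩
        have hd2 : d + x ∈ domf := (mC _).2
          ⟨(AffineSubspace.vadd_mem_iff_mem_direction d hx2.1).2 hd.2, fun i => by
            have := hz (Sum.inr (Sum.inl i))
            simp only [Sum.elim_inl, Sum.elim_inr, hres] at this
            rw [map_add]; linarith⟩
        have h1 := hmin _ hd1
        rw [hfg _ hd2, hfg _ hxdom, EReal.coe_le_coe_iff] at h1
        have h2 : g (d + x) ≤ g x + t := by
          refine Finset.sup'_le _ _ fun k _ => ?_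
          have := hz (Sum.inr (Sum.inr k))
          simp only [Sum.elim_inr, hres, LinearMap.sub_apply, LinearMap.snd_apply] at this
          rw [map_add]; linarith
        simp only [LinearMap.neg_apply, LinearMap.snd_apply]
        linarith)
    simp only [Fintype.sum_sum_type, Sum.elim_inl, Sum.elim_inr, hres, LinearMap.sub_apply,
      LinearMap.snd_apply, LinearMap.neg_apply] at hc
    let μ : Fin p → ℝ := fun i => c (Sum.inl i)
    let ν : Fin q → ℝ := fun i => c (Sum.inr (Sum.inl i))
    let l : Fin (m + 1) → ℝ := fun i => c (Sum.inr (Sum.inr i))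
    have hμr : ∀ i, μ i * (α i - a i x) = 0 := fun i => hcr (Sum.inl i)
    have hνr : ∀ i, ν i * (γ i - b i x) = 0 := fun i => hcr (Sum.inr (Sum.inl i))
    have hlr : ∀ i, l i * (g x - (v i x + β i)) = 0 := fun i => hcr (Sum.inr (Sum.inr i))
    have hμ0 : ∀ i, 0 ≤ μ i := fun i => hc0 _
    have hν0 : ∀ i, 0 ≤ ν i := fun i => hc0 _
    have hl0 : ∀ i, 0 ≤ l i := fun i => hc0 _
    have hl1 : ∑ k, l k = 1 := by
      have := hc (0, 1)
      simp at this
      simp only [l]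
      linarith
    let wa : X →L[ℝ] ℝ := ∑ i, μ i • a i
    let wb : X →L[ℝ] ℝ := ∑ i, ν i • b i
    let wv : X →L[ℝ] ℝ := ∑ i, l i • v i
    have ea : ∀ u, wa u = ∑ i, μ i * a i u := fun u => by simp [wa]
    have eb : ∀ u, wb u = ∑ i, ν i * b i u := fun u => by simp [wb]
    have ev : ∀ u, wv u = ∑ i, l i * v i u := fun u => by simp [wv]
    obtain ⟨H, hH1, hH2⟩ := annih_split L1.direction L2.direction
      (dir_closed L1 hL1 x hx1.1) (dir_closed L2 hL2 x hx2.1) hE (wa + wb + wv) (by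
        intro d hd1 hd2
        have := hc (⟨d, hd1, hd2⟩, 0)
        simp only [ContinuousLinearMap.add_apply, ea, eb, ev]
        simp only [sub_zero, neg_zero] at this
        rw [add_assoc]
        exact this.symm)
    refine Set.mem_add.2 ⟨wb + wv - H, ?_, H - wb - wv, ?_, by abel⟩
    · intro u
      by_cases hu : u ∈ domf
      · rw [hfg u hu, hfg x hxdom, ← EReal.coe_sub, EReal.coe_le_coe_iff]
        have hu2 := (mC u).1 hu
        have h1 : H (u - x) = 0 := hH2 _ (AffineSubspace.vsub_mem_direction hu2.1 hx2.1)
        have h2 : wb u - wb x ≤ 0 := by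
          rw [eb, eb, ← Finset.sum_sub_distrib]
          refine Finset.sum_nonpos fun i _ => ?_
          have := hνr i
          have := mul_le_mul_of_nonneg_left (hu2.2 i) (hν0 i)
          linarith
        have h3 : wv u - wv x ≤ g u - g x := by
          rw [ev, ev, ← Finset.sum_sub_distrib, ← one_mul (g u - g x), ← hl1, Finset.sum_mul]
          refine Finset.sum_le_sum fun i _ => ?_
          have := hlr i
          have hg : v i u + β i ≤ g u :=
            Finset.le_sup' (fun k => v k u + β k) (Finset.mem_univ i)
          have := mul_le_mul_of_nonneg_left hg (hl0 i)
          linarith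
        rw [map_sub] at h1
        simp only [ContinuousLinearMap.add_apply, ContinuousLinearMap.sub_apply]
        linarith
      · rw [hf' u hu, hfg x hxdom, EReal.top_sub_coe]
        exact le_top
    · intro u hu
      have hu1 := (mD u).1 hu
      have h1 : H (u - x) = _ := hH1 _ (AffineSubspace.vsub_mem_direction hu1.1 hx1.1)
      have h2 : wa u - wa x ≤ 0 := by
        rw [ea, ea, ← Finset.sum_sub_distrib]
        refine Finset.sum_nonpos fun i _ => ?_
        have := hμr i
        have := mul_le_mul_of_nonneg_left (hu1.2 i) (hμ0 i)
        linarith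
      simp only [map_sub, ContinuousLinearMap.add_apply] at h1
      simp only [ContinuousLinearMap.sub_apply]
      linarith
  · intro h0 u hu
    obtain ⟨φ, hφ, η, hη, hs⟩ := Set.mem_add.1 h0
    by_cases hud : u ∈ domf
    · have h1 := hφ u
      rw [hfg u hud, hfg x hxdom, ← EReal.coe_sub, EReal.coe_le_coe_iff] at h1
      rw [hfg u hud, hfg x hxdom, EReal.coe_le_coe_iff]
      have h2 : η u - η x ≤ 0 := hη u hu
      have h3 : φ u + η u = 0 := by rw [← ContinuousLinearMap.add_apply, hs]; rfl
      have h4 : φ x + η x = 0 := by rw [← ContinuousLinearMap.add_apply, hs]; rfl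
      linarith
    · rw [hf' u hud]
      exact le_top
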